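/- (Local energy identity for the liquid crystal system) Let Ω ⊆ ℝ³ be open, T ∈ (0,∞), and let u,d : Ω×(0,T) → ℝ³ and p : Ω×(0,T) → ℝ be C^∞ and satisfy pointwise on Ω×(0,T): ∂_t u_i − Δu_i + Σ_j ∂_j( u_i u_j + Σ_k ∂_i d_k ∂_j d_k ) + ∂_i p = 0 for i=1,2,3; Σ_i ∂_i u_i = 0; and ∂_t d − Δd + (u·∇)d + f(d) = 0, where f(x) := 4(|x|²−1)x. Then for every φ ∈ C_c^∞(Ω×(0,T);ℝ) and every t ∈ (0,T): (d/dt) ∫_Ω ( |u|²/2 + |∇d|²/2 ) φ dx + ∫_Ω ( |∇u|² + |∇²d|² ) φ dx = ∫_Ω [ ( |u|²/2 + |∇d|²/2 )(∂_tφ + Δφ) + ( |u|²/2 + |∇d|²/2 + p ) u·∇φ + u⊗∇φ : ∇d⊙∇d − φ Σ_{i,j} ∂_j( f(d) )_i ∂_j d_i ] dx, where all integrands are evaluated at time t. -/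

import Mathlib

open MeasureTheory Set Filter
open scoped ENNReal NNReal

noncomputable section

abbrev E3 : Type := EuclideanSpace ℝ (Fin 3)

/-- Space-time `ℝ³ × ℝ`. -/
abbrev SpT : Type := E3 × ℝ

/-- Spatial partial derivative `∂_j` of a function on space-time. -/
def sderiv (j : Fin 3) (ψ : SpT → ℝ) (z : SpT) : ℝ :=
  fderiv ℝ ψ z ((EuclideanSpace.single j 1 : E3), (0 : ℝ))

/-- Time derivative `∂_t` of a function on space-time. -/
def tderiv (ψ : SpT → ℝ) (z : SpT) : ℝ :=
  fderiv ℝ ψ z ((0 : E3), (1 : ℝ))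

/-- Spatial Laplacian of a function on space-time. -/
def sLap (ψ : SpT → ℝ) (z : SpT) : ℝ := ∑ j, sderiv j (sderiv j ψ) z

/-- `ψ ∈ C_c^∞(U)`. -/
def IsTestOn (U : Set SpT) (ψ : SpT → ℝ) : Prop :=
  ContDiff ℝ (⊤ : ℕ∞) ψ ∧ HasCompactSupport ψ ∧ tsupport ψ ⊆ U

/-- `g` is the weak spatial gradient of `f` on `U`. -/
def WeakSGrad (U : Set SpT) (f : SpT → ℝ) (g : Fin 3 → SpT → ℝ) : Prop :=
  ∀ (j : Fin 3) (ψ : SpT → ℝ), IsTestOn U ψ →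
    ∫ z in U, f z * sderiv j ψ z = - ∫ z in U, g j z * ψ z

/-- Squared Frobenius norm of a `3×3` array, e.g. `|∇v|² = Σ_{i,j} (∂_j v_i)²`. -/
def nsq2 (M : Fin 3 → Fin 3 → ℝ) : ℝ := ∑ i, ∑ j, (M i j) ^ 2

/-- Squared norm of a `3×3×3` array, e.g. `|∇²d|² = Σ_{i,j,k} (∂_j ∂_k d_i)²`. -/
def nsq3 (A : Fin 3 → Fin 3 → Fin 3 → ℝ) : ℝ := ∑ i, ∑ j, ∑ k, (A i j k) ^ 2

/-- Open Euclidean ball in `ℝ³`. -/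
def ball3 (x : E3) (r : ℝ) : Set E3 := Metric.ball x r

/-- Parabolic cylinder `Q_r(z₀) = B_r(x₀) × (t₀ - r², t₀)`. -/
def Qcyl (z : SpT) (r : ℝ) : Set SpT := ball3 z.1 r ×ˢ Ioo (z.2 - r ^ 2) z.2

/-- Centered parabolic cylinder `Q*_r(z₀) = B_r(x₀) × (t₀ - (7/8)r², t₀ + (1/8)r²)`. -/
def Qstar (z : SpT) (r : ℝ) : Set SpT :=
  ball3 z.1 r ×ˢ Ioo (z.2 - 7 / 8 * r ^ 2) (z.2 + 1 / 8 * r ^ 2)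

/-- The time interval `I*_r(t₀) = (t₀ - (7/8)r², t₀ + (1/8)r²)`. -/
def Istar (t₀ r : ℝ) : Set ℝ := Ioo (t₀ - 7 / 8 * r ^ 2) (t₀ + 1 / 8 * r ^ 2)

/-- `|∇v|² = Σ_{i,j} (∂_j v_i)²` for a smooth vector field, via classical derivatives. -/
def cNgrad (v : SpT → E3) (z : SpT) : ℝ :=
  ∑ i, ∑ j, (sderiv j (fun w => v w i) z) ^ 2

/-- `|∇²v|² = Σ_{i,j,k} (∂_j ∂_k v_i)²` for a smooth vector field. -/
def cNgrad2 (v : SpT → E3) (z : SpT) : ℝ :=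
  ∑ i, ∑ j, ∑ k, (sderiv j (sderiv k (fun w => v w i)) z) ^ 2

open Topology

section DirectionalDerivatives

variable {U : Set SpT} {f g : SpT → ℝ} {z : SpT}

theorem ContDiffOn.differentiableAt_of_isOpen (hU : IsOpen U) (hf : ContDiffOn ℝ (⊤ : ℕ∞) f U)
    (hz : z ∈ U) : DifferentiableAt ℝ f z :=
  (hf.contDiffAt (hU.mem_nhds hz)).differentiableAt (by simp)

theorem ContDiffOn.fderiv_apply_of_isOpen (hU : IsOpen U) (hf : ContDiffOn ℝ (⊤ : ℕ∞) f U)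
    (v : SpT) : ContDiffOn ℝ (⊤ : ℕ∞) (fun w => fderiv ℝ f w v) U :=
  (hf.fderiv_of_isOpen hU (m := (⊤ : ℕ∞)) (by simp)).clm_apply contDiffOn_const

theorem fderiv_apply_congr_of_isOpen (hU : IsOpen U) (h : ∀ w ∈ U, f w = g w) (hz : z ∈ U)
    (v : SpT) : fderiv ℝ f z v = fderiv ℝ g z v := by
  have : f =ᶠ[𝓝 z] g := by filter_upwards [hU.mem_nhds hz] with w hw using h w hw
  rw [this.fderiv_eq]

theorem fderiv_apply_comm_of_isOpen (hU : IsOpen U) (hf : ContDiffOn ℝ (⊤ : ℕ∞) f U)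
    (hz : z ∈ U) (v w : SpT) :
    fderiv ℝ (fun y => fderiv ℝ f y v) z w = fderiv ℝ (fun y => fderiv ℝ f y w) z v := by
  have hd : DifferentiableAt ℝ (fderiv ℝ f) z :=
    ((hf.fderiv_of_isOpen hU (m := (⊤ : ℕ∞)) (by simp)).contDiffAt
      (hU.mem_nhds hz)).differentiableAt (by simp)
  have hs := (hf.contDiffAt (hU.mem_nhds hz)).isSymmSndFDerivAt
    (by simpa using WithTop.coe_le_coe.2 (le_top : (2 : ℕ∞) ≤ ⊤))
  rw [fderiv_clm_apply hd (by fun_prop), fderiv_clm_apply hd (by fun_prop)]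
  simpa using hs w v

theorem fderiv_apply_add (hf : DifferentiableAt ℝ f z) (hg : DifferentiableAt ℝ g z) (v : SpT) :
    fderiv ℝ (fun w => f w + g w) z v = fderiv ℝ f z v + fderiv ℝ g z v := by
  rw [fderiv_fun_add hf hg]; rfl

theorem fderiv_apply_sub (hf : DifferentiableAt ℝ f z) (hg : DifferentiableAt ℝ g z) (v : SpT) :
    fderiv ℝ (fun w => f w - g w) z v = fderiv ℝ f z v - fderiv ℝ g z v := by
  rw [fderiv_fun_sub hf hg]; rfl

theorem fderiv_apply_mul (hf : DifferentiableAt ℝ f z) (hg : DifferentiableAt ℝ g z) (v : SpT) :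
    fderiv ℝ (fun w => f w * g w) z v = fderiv ℝ f z v * g z + f z * fderiv ℝ g z v := by
  rw [fderiv_fun_mul hf hg]
  simp only [_root_.add_apply, _root_.smul_apply, smul_eq_mul]
  ring

theorem fderiv_apply_sum {ι : Type*} [Fintype ι] {a : ι → SpT → ℝ}
    (ha : ∀ i, DifferentiableAt ℝ (a i) z) (v : SpT) :
    fderiv ℝ (fun w => ∑ i, a i w) z v = ∑ i, fderiv ℝ (a i) z v := by
  rw [fderiv_fun_sum fun i _ => ha i, _root_.sum_apply]

theorem fderiv_apply_half_sum_sq {ι : Type*} [Fintype ι] {a : ι → SpT → ℝ}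
    (ha : ∀ i, DifferentiableAt ℝ (a i) z) (v : SpT) :
    fderiv ℝ (fun w => ∑ i, a i w ^ 2 / 2) z v = ∑ i, a i z * fderiv ℝ (a i) z v := by
  have h (i) : DifferentiableAt ℝ (fun w => a i w ^ 2 / 2) z := by
    have := ha i; fun_prop
  rw [fderiv_apply_sum h]
  refine Finset.sum_congr rfl fun i _ => ?_
  have : (fun w => a i w ^ 2 / 2) = fun w => (a i w * (1 / 2)) * a i w := by
    ext w; ring
  rw [this, fderiv_apply_mul ((ha i).mul_const _) (ha i),
    fderiv_apply_mul (ha i) (differentiableAt_const _)]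
  simp
  ring

theorem fderiv_apply_fderiv_apply_half_sum_sq {ι : Type*} [Fintype ι] {a : ι → SpT → ℝ}
    (hU : IsOpen U) (ha : ∀ i, ContDiffOn ℝ (⊤ : ℕ∞) (a i) U) (hz : z ∈ U) (v : SpT) :
    fderiv ℝ (fun y => fderiv ℝ (fun w => ∑ i, a i w ^ 2 / 2) y v) z v =
      ∑ i, (a i z * fderiv ℝ (fun y => fderiv ℝ (a i) y v) z v + fderiv ℝ (a i) z v ^ 2) := by
  have hd (i) {y} (hy : y ∈ U) := (ha i).differentiableAt_of_isOpen hU hy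
  have hd' (i) := ((ha i).fderiv_apply_of_isOpen hU v).differentiableAt_of_isOpen hU hz
  rw [fderiv_apply_congr_of_isOpen hU
    (fun y hy => fderiv_apply_half_sum_sq (fun i => hd i hy) v) hz,
    fderiv_apply_sum (a := fun i w => a i w * fderiv ℝ (a i) w v)
      fun i => (hd i hz).mul (hd' i)]
  refine Finset.sum_congr rfl fun i _ => ?_
  rw [fderiv_apply_mul (hd i hz) (hd' i)]
  ring

end DirectionalDerivatives

section TestFunctions

variable {U : Set SpT} {F G φ : SpT → ℝ}

theorem IsTestOn.mul_left {g : SpT → ℝ} (hU : IsOpen U) (hg : ContDiffOn ℝ (⊤ : ℕ∞) g U)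
    (hφ : IsTestOn U φ) : IsTestOn U (fun z => g z * φ z) := by
  refine ⟨contDiff_iff_contDiffAt.2 fun z => ?_, hφ.2.1.mul_left,
    (tsupport_mul_subset_right (f := g) (g := φ)).trans hφ.2.2⟩
  by_cases hz : z ∈ tsupport φ
  · exact (hg.contDiffAt (hU.mem_nhds (hφ.2.2 hz))).mul hφ.1.contDiffAt
  · refine (contDiffAt_const (c := (0 : ℝ))).congr_of_eventuallyEq ?_
    filter_upwards [notMem_tsupport_iff_eventuallyEq.1 hz] with w hw
    simp [hw]

theorem IsTestOn.sub (hF : IsTestOn U F) (hG : IsTestOn U G) :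
    IsTestOn U (fun z => F z - G z) :=
  ⟨hF.1.sub hG.1, hF.2.1.sub hG.2.1,
    (tsupport_sub F G).trans (union_subset hF.2.2 hG.2.2)⟩

theorem IsTestOn.fderiv_apply (hF : IsTestOn U F) (v : SpT) :
    IsTestOn U (fun z => fderiv ℝ F z v) :=
  ⟨(hF.1.fderiv_right (m := (⊤ : ℕ∞)) (by simp)).clm_apply contDiff_const,
    hF.2.1.fderiv_apply ℝ v, (tsupport_fderiv_apply_subset ℝ v).trans hF.2.2⟩

theorem IsTestOn.hasCompactSupport_slice (hF : IsTestOn U F) (t : ℝ) :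
    HasCompactSupport fun x : E3 => F (x, t) :=
  HasCompactSupport.intro (hF.2.1.image continuous_fst) fun _ hx =>
    image_eq_zero_of_notMem_tsupport fun h => hx ⟨_, h, rfl⟩

theorem IsTestOn.integrable_slice (hF : IsTestOn U F) (t : ℝ) :
    Integrable fun x : E3 => F (x, t) :=
  (hF.1.continuous.comp (by fun_prop)).integrable_of_hasCompactSupport
    (hF.hasCompactSupport_slice t)

theorem IsTestOn.integral_sderiv_slice (hF : IsTestOn U F) (j : Fin 3) (t : ℝ) :
    ∫ x : E3, sderiv j F (x, t) = 0 := by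
  have hfd (x : E3) : HasFDerivAt (fun y : E3 => F (y, t))
      ((fderiv ℝ F (x, t)).comp (ContinuousLinearMap.inl ℝ E3 ℝ)) x :=
    ((hF.1.differentiable (by simp)) (x, t)).hasFDerivAt.comp x (hasFDerivAt_prodMk_left x t)
  have hv (x : E3) : fderiv ℝ (fun y : E3 => F (y, t)) x (EuclideanSpace.single j 1) =
      sderiv j F (x, t) := by
    rw [(hfd x).fderiv]; rfl
  have key := integral_mul_fderiv_eq_neg_fderiv_mul_of_integrable (μ := (volume : Measure E3))
    (f := fun _ : E3 => (1 : ℝ)) (g := fun y : E3 => F (y, t))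
    (v := (EuclideanSpace.single j 1 : E3)) (by simp)
    (by
      simp only [hv, one_mul]
      exact (hF.fderiv_apply (EuclideanSpace.single j 1, 0)).integrable_slice t)
    (by simpa using hF.integrable_slice t) (fun x _ => differentiableAt_const _)
    (fun x _ => (hfd x).differentiableAt)
  simpa [hv] using key

theorem IsTestOn.setIntegral_sderiv_slice {Ω : Set E3} {I : Set ℝ} (hF : IsTestOn (Ω ×ˢ I) F)
    (j : Fin 3) (t : ℝ) : ∫ x in Ω, sderiv j F (x, t) = 0 := by
  rw [setIntegral_eq_integral_of_forall_compl_eq_zero fun _ hx => ?_]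
  · exact hF.integral_sderiv_slice j t
  · exact image_eq_zero_of_notMem_tsupport fun h =>
      hx ((hF.fderiv_apply (EuclideanSpace.single j 1, 0)).2.2 h).1

theorem IsTestOn.hasDerivAt_setIntegral_slice (hF : IsTestOn U F) (Ω : Set E3) (t : ℝ) :
    HasDerivAt (fun s => ∫ x in Ω, F (x, s)) (∫ x in Ω, tderiv F (x, t)) t := by
  have hT := hF.fderiv_apply (0, 1)
  obtain ⟨C, hC⟩ := hT.2.1.exists_bound_of_continuous hT.1.continuous
  set K : Set E3 := image Prod.fst (tsupport fun z => fderiv ℝ F z (0, 1))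
  have hKc : IsCompact K := hT.2.1.image continuous_fst
  refine (hasDerivAt_integral_of_dominated_loc_of_deriv_le (s := univ)
    (F' := fun s x => tderiv F (x, s)) (bound := K.indicator fun _ => C) univ_mem
    (.of_forall fun s => (hF.integrable_slice s).aestronglyMeasurable.restrict)
    (hF.integrable_slice t).restrict (hT.integrable_slice t).aestronglyMeasurable.restrict
    (.of_forall fun x s _ => ?_) ?_ (.of_forall fun x s _ => ?_)).2
  · by_cases hx : x ∈ K
    · rw [indicator_of_mem hx]; exact hC (x, s)
    · have : tderiv F (x, s) = 0 :=
        image_eq_zero_of_notMem_tsupport fun h => hx ⟨_, h, rfl⟩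
      simp [hx, this]
  · exact ((integrable_indicator_iff hKc.measurableSet).2
      (integrableOn_const hKc.measure_lt_top.ne)).restrict
  · exact ((hF.1.differentiable (by simp)) (x, s)).hasFDerivAt.comp_hasDerivAt s
      ((hasDerivAt_const s x).prodMk (hasDerivAt_id s))

end TestFunctions
theorem energy_density_algebra (u ut P φ1 φ2 : Fin 3 → ℝ) (U1 U2 D Dt f : Fin 3 → Fin 3 → ℝ)
    (H L : Fin 3 → Fin 3 → Fin 3 → ℝ) (p φ φt : ℝ)
    (hmom : ∀ i, ut i - (∑ j, U2 j i) + (∑ j, ((U1 j i * u j + u i * U1 j j) +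
      ∑ k, (H j i k * D j k + D i k * H j j k))) + P i = 0)
    (hdiv : ∑ i, U1 i i = 0)
    (hdir : ∀ j i, Dt j i - (∑ k, L k j i) + (∑ k, (U1 j k * D k i + u k * H k j i)) + f j i = 0)
    (e et : ℝ) (e1 e2 : Fin 3 → ℝ)
    (het : et = ∑ i, u i * ut i + ∑ i, ∑ j, D j i * Dt j i)
    (he1 : ∀ l, e1 l = ∑ i, u i * U1 l i + ∑ i, ∑ j, D j i * H l j i)
    (he2 : ∀ l, e2 l = ∑ i, (u i * U2 l i + U1 l i ^ 2) +
      ∑ i, ∑ j, (D j i * L l j i + H l j i ^ 2)) :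
    e * (φt + ∑ j, φ2 j) + (e + p) * (∑ j, u j * φ1 j) +
        (∑ i, ∑ j, u i * φ1 j * ∑ k, D i k * D j k) - φ * (∑ i, ∑ j, f j i * D j i) =
      (et * φ + e * φt) +
        ((∑ i, ∑ j, U1 j i ^ 2) + ∑ i, ∑ j, ∑ k, H j k i ^ 2) * φ -
        ∑ j, ((e2 j - ((e1 j + P j) * u j + (e + p) * U1 j j) -
            ∑ i, (U1 j i * (∑ k, D i k * D j k) +
              u i * ∑ k, (H j i k * D j k + D i k * H j j k))) * φ +
          (e1 j - (e + p) * u j - ∑ i, u i * ∑ k, D i k * D j k) * φ1 j -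
          (e1 j * φ1 j + e * φ2 j)) := by
  have key : et - ∑ j, e2 j + (∑ i, ∑ j, U1 j i ^ 2) + (∑ i, ∑ j, ∑ k, H j k i ^ 2) +
      (∑ j, (e1 j + P j) * u j) + (∑ j, ∑ i, (U1 j i * (∑ k, D i k * D j k) +
              u i * ∑ k, (H j i k * D j k + D i k * H j j k))) + (∑ i, ∑ j, f j i * D j i) = 0 := by
    have h1 : ∑ i, u i * (ut i - (∑ j, U2 j i) + (∑ j, ((U1 j i * u j + u i * U1 j j) +
      ∑ k, (H j i k * D j k + D i k * H j j k))) + P i) = 0 := by simp [hmom]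
    have h2 : ∑ j, ∑ i, D j i * (Dt j i - (∑ k, L k j i) +
        (∑ k, (U1 j k * D k i + u k * H k j i)) + f j i) = 0 := by simp [hdir]
    subst het
    simp only [he1, he2, Fin.sum_univ_three] at h1 h2 hdiv ⊢
    linear_combination h1 + h2 - (u 0 ^ 2 + u 1 ^ 2 + u 2 ^ 2) * hdiv
  simp only [Fin.sum_univ_three] at key hdiv ⊢
  linear_combination -φ * key - φ * (e + p) * hdiv

section EnergyDensity

/-- The energy density `|u|²/2 + |∇d|²/2`. -/
def energyDensity (u d : SpT → E3) (z : SpT) : ℝ := ‖u z‖ ^ 2 / 2 + cNgrad d z / 2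

/-- The `j`-th component `Σ_i u_i ∂_i d · ∂_j d` of the Ericksen stress applied to the velocity. -/
def stressFlux (u d : SpT → E3) (j : Fin 3) (z : SpT) : ℝ :=
  ∑ i, u z i * ∑ k, sderiv i (fun w => d w k) z * sderiv j (fun w => d w k) z

/-- The `j`-th component of the energy flux. -/
def energyFlux (u d : SpT → E3) (p : SpT → ℝ) (j : Fin 3) (z : SpT) : ℝ :=
  sderiv j (energyDensity u d) z - (energyDensity u d z + p z) * u z j - stressFlux u d j z

/-- The fields whose squares add up to twice the energy density. -/
def energyComponents (u d : SpT → E3) : Fin 3 ⊕ Fin 3 × Fin 3 → SpT → ℝ :=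
  Sum.elim (fun i w => u w i) fun ij => sderiv ij.2 fun w => d w ij.1

theorem energyDensity_eq_half_sum_sq (u d : SpT → E3) :
    energyDensity u d = fun z => ∑ i, energyComponents u d i z ^ 2 / 2 := by
  ext z
  simp [energyDensity, energyComponents, cNgrad, EuclideanSpace.real_norm_sq_eq,
    Fintype.sum_prod_type, Finset.sum_div]

variable {U : Set SpT} {u d : SpT → E3} {p φ : SpT → ℝ}

theorem ContDiffOn.component (hu : ContDiffOn ℝ (⊤ : ℕ∞) u U) (i : Fin 3) :
    ContDiffOn ℝ (⊤ : ℕ∞) (fun w => u w i) U :=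
  contDiffOn_euclidean.1 hu i

theorem ContDiffOn.sderiv (hU : IsOpen U) (hφ : ContDiffOn ℝ (⊤ : ℕ∞) φ U) (j : Fin 3) :
    ContDiffOn ℝ (⊤ : ℕ∞) (sderiv j φ) U :=
  hφ.fderiv_apply_of_isOpen hU _

theorem contDiffOn_energyComponents (hU : IsOpen U) (hu : ContDiffOn ℝ (⊤ : ℕ∞) u U)
    (hd : ContDiffOn ℝ (⊤ : ℕ∞) d U) (i) :
    ContDiffOn ℝ (⊤ : ℕ∞) (energyComponents u d i) U := by
  rcases i with i | ⟨i, j⟩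
  · exact hu.component i
  · exact (hd.component i).sderiv hU j

theorem contDiffOn_energyDensity (hU : IsOpen U) (hu : ContDiffOn ℝ (⊤ : ℕ∞) u U)
    (hd : ContDiffOn ℝ (⊤ : ℕ∞) d U) : ContDiffOn ℝ (⊤ : ℕ∞) (energyDensity u d) U := by
  rw [energyDensity_eq_half_sum_sq]
  exact ContDiffOn.sum fun i _ => ((contDiffOn_energyComponents hU hu hd i).pow 2).div_const 2

theorem contDiffOn_stressFlux (hU : IsOpen U) (hu : ContDiffOn ℝ (⊤ : ℕ∞) u U)
    (hd : ContDiffOn ℝ (⊤ : ℕ∞) d U) (j : Fin 3) :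
    ContDiffOn ℝ (⊤ : ℕ∞) (stressFlux u d j) U :=
  ContDiffOn.sum fun i _ => (hu.component i).mul <| ContDiffOn.sum fun k _ =>
    ((hd.component k).sderiv hU i).mul ((hd.component k).sderiv hU j)

theorem contDiffOn_energyFlux (hU : IsOpen U) (hu : ContDiffOn ℝ (⊤ : ℕ∞) u U)
    (hd : ContDiffOn ℝ (⊤ : ℕ∞) d U) (hp : ContDiffOn ℝ (⊤ : ℕ∞) p U) (j : Fin 3) :
    ContDiffOn ℝ (⊤ : ℕ∞) (energyFlux u d p j) U :=
  (((contDiffOn_energyDensity hU hu hd).sderiv hU j).sub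
    (((contDiffOn_energyDensity hU hu hd).add hp).mul (hu.component j))).sub
    (contDiffOn_stressFlux hU hu hd j)

theorem contDiffOn_dissipation (hU : IsOpen U) (hu : ContDiffOn ℝ (⊤ : ℕ∞) u U)
    (hd : ContDiffOn ℝ (⊤ : ℕ∞) d U) :
    ContDiffOn ℝ (⊤ : ℕ∞) (fun z => cNgrad u z + cNgrad2 d z) U :=
  (ContDiffOn.sum fun i _ => ContDiffOn.sum fun j _ => ((hu.component i).sderiv hU j).pow 2).add
    (ContDiffOn.sum fun i _ => ContDiffOn.sum fun j _ => ContDiffOn.sum fun k _ =>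
      (((hd.component i).sderiv hU k).sderiv hU j).pow 2)

/-- The director equation differentiated in space. -/
theorem sderiv_director_equation (hU : IsOpen U) (hu : ContDiffOn ℝ (⊤ : ℕ∞) u U)
    (hd : ContDiffOn ℝ (⊤ : ℕ∞) d U)
    (hdeq : ∀ z ∈ U, ∀ i : Fin 3,
      tderiv (fun w => d w i) z - (∑ j, sderiv j (sderiv j (fun w => d w i)) z) +
        (∑ j, u z j * sderiv j (fun w => d w i) z) +
        4 * (‖d z‖ ^ 2 - 1) * d z i = 0) {z : SpT} (hz : z ∈ U) (j i : Fin 3) :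
    tderiv (sderiv j fun w => d w i) z -
        (∑ k, sderiv k (sderiv k (sderiv j fun w => d w i)) z) +
        (∑ k, (sderiv j (fun w => u w k) z * sderiv k (fun w => d w i) z +
          u z k * sderiv k (sderiv j fun w => d w i) z)) +
        sderiv j (fun w => 4 * (‖d w‖ ^ 2 - 1) * d w i) z = 0 := by
  have hdi := hd.component i
  have hcomm {f : SpT → ℝ} (hf : ContDiffOn ℝ (⊤ : ℕ∞) f U) (k : Fin 3) :
      ∀ w ∈ U, sderiv j (sderiv k f) w = sderiv k (sderiv j f) w :=
    fun w hw => fderiv_apply_comm_of_isOpen hU hf hw _ _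
  have ht : sderiv j (tderiv fun w => d w i) z = tderiv (sderiv j fun w => d w i) z :=
    fderiv_apply_comm_of_isOpen hU hdi hz _ _
  have hlap (k : Fin 3) : sderiv j (sderiv k (sderiv k fun w => d w i)) z =
      sderiv k (sderiv k (sderiv j fun w => d w i)) z :=
    (hcomm (hdi.sderiv hU k) k z hz).trans
      (fderiv_apply_congr_of_isOpen hU (hcomm hdi k) hz _)
  have h1 := (hdi.fderiv_apply_of_isOpen hU (0, 1)).differentiableAt_of_isOpen hU hz
  have h2 (k : Fin 3) :=
    ((hdi.sderiv hU k).sderiv hU k).differentiableAt_of_isOpen hU hz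
  have hu1 (k : Fin 3) := (hu.component k).differentiableAt_of_isOpen hU hz
  have hd1 (k : Fin 3) := (hdi.sderiv hU k).differentiableAt_of_isOpen hU hz
  have h4 : DifferentiableAt ℝ (fun w => 4 * (‖d w‖ ^ 2 - 1) * d w i) z :=
    (((((hd.contDiffAt (hU.mem_nhds hz)).norm_sq ℝ).differentiableAt (by simp)).sub_const
      1).const_mul 4).mul (hdi.differentiableAt_of_isOpen hU hz)
  have h3 := DifferentiableAt.fun_sum (u := Finset.univ) fun k _ => (hu1 k).mul (hd1 k)
  have h2s := DifferentiableAt.fun_sum (u := Finset.univ) fun k _ => h2 k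
  have key : sderiv j (fun z => tderiv (fun w => d w i) z -
        (∑ j, sderiv j (sderiv j (fun w => d w i)) z) +
        (∑ j, u z j * sderiv j (fun w => d w i) z) +
        4 * (‖d z‖ ^ 2 - 1) * d z i) z = 0 := by
    refine (fderiv_apply_congr_of_isOpen hU (g := fun _ => 0) (fun w hw => hdeq w hw i) hz
      _).trans ?_
    simp
  refine Eq.trans ?_ key
  symm
  refine (fderiv_apply_add ((h1.sub h2s).add h3) h4 _).trans (congrArg₂ _ ?_ rfl)
  refine (fderiv_apply_add (h1.sub h2s) h3 _).trans (congrArg₂ _ ?_ ?_)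
  · refine (fderiv_apply_sub h1 h2s _).trans (congrArg₂ _ ht ?_)
    exact (fderiv_apply_sum h2 _).trans (Finset.sum_congr rfl fun k _ => hlap k)
  · refine (fderiv_apply_sum (fun k => (hu1 k).mul (hd1 k)) _).trans
      (Finset.sum_congr rfl fun k _ => ?_)
    refine (fderiv_apply_mul (hu1 k) (hd1 k) _).trans (congrArg₂ _ rfl ?_)
    exact congrArg _ (hcomm hdi k z hz)

/-- The pointwise local energy identity in divergence form. -/
theorem energy_identity_pointwise (hU : IsOpen U) (hu : ContDiffOn ℝ (⊤ : ℕ∞) u U)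
    (hd : ContDiffOn ℝ (⊤ : ℕ∞) d U) (hp : ContDiffOn ℝ (⊤ : ℕ∞) p U)
    (hφ : ContDiff ℝ (⊤ : ℕ∞) φ)
    (hmom : ∀ z ∈ U, ∀ i : Fin 3,
      tderiv (fun w => u w i) z - (∑ j, sderiv j (sderiv j (fun w => u w i)) z) +
        (∑ j, sderiv j (fun w => u w i * u w j +
          ∑ k, sderiv i (fun w' => d w' k) w * sderiv j (fun w' => d w' k) w) z) +
        sderiv i p z = 0)
    (hdiv : ∀ z ∈ U, ∑ i, sderiv i (fun w => u w i) z = 0)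
    (hdeq : ∀ z ∈ U, ∀ i : Fin 3,
      tderiv (fun w => d w i) z - (∑ j, sderiv j (sderiv j (fun w => d w i)) z) +
        (∑ j, u z j * sderiv j (fun w => d w i) z) +
        4 * (‖d z‖ ^ 2 - 1) * d z i = 0) {z : SpT} (hz : z ∈ U) :
    energyDensity u d z * (tderiv φ z + sLap φ z) +
        (energyDensity u d z + p z) * (∑ j, u z j * sderiv j φ z) +
        (∑ i, ∑ j, u z i * sderiv j φ z *
          (∑ k, sderiv i (fun w => d w k) z * sderiv j (fun w => d w k) z)) -
        φ z * (∑ i, ∑ j, sderiv j (fun w => 4 * (‖d w‖ ^ 2 - 1) * d w i) z *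
          sderiv j (fun w => d w i) z) =
      tderiv (fun w => energyDensity u d w * φ w) z + (cNgrad u z + cNgrad2 d z) * φ z -
        ∑ j, sderiv j
          (fun w => energyFlux u d p j w * φ w - energyDensity u d w * sderiv j φ w) z := by
  have hφU : ContDiffOn ℝ (⊤ : ℕ∞) φ U := hφ.contDiffOn
  have hE := contDiffOn_energyDensity hU hu hd
  have hE1 := hE.differentiableAt_of_isOpen hU hz
  have hp1 := hp.differentiableAt_of_isOpen hU hz
  have hφ1 := hφU.differentiableAt_of_isOpen hU hz
  have hdφ (j : Fin 3) := (hφU.sderiv hU j).differentiableAt_of_isOpen hU hz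
  have hdE (j : Fin 3) := (hE.sderiv hU j).differentiableAt_of_isOpen hU hz
  have hu1 (i : Fin 3) := (hu.component i).differentiableAt_of_isOpen hU hz
  have hd1 (i k : Fin 3) := ((hd.component k).sderiv hU i).differentiableAt_of_isOpen hU hz
  have hS1 (j : Fin 3) := (contDiffOn_stressFlux hU hu hd j).differentiableAt_of_isOpen hU hz
  have hF1 (j : Fin 3) := (contDiffOn_energyFlux hU hu hd hp j).differentiableAt_of_isOpen hU hz
  have ha := contDiffOn_energyComponents hU hu hd
  have ha1 (i) := (ha i).differentiableAt_of_isOpen hU hz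
  have hdd (i j : Fin 3) := DifferentiableAt.fun_sum (u := Finset.univ)
    fun k _ => (hd1 i k).mul (hd1 j k)
  have hstress (i j l : Fin 3) : sderiv l (fun w =>
      ∑ k, sderiv i (fun w' => d w' k) w * sderiv j (fun w' => d w' k) w) z =
      ∑ k, (sderiv l (sderiv i fun w => d w k) z * sderiv j (fun w => d w k) z +
        sderiv i (fun w => d w k) z * sderiv l (sderiv j fun w => d w k) z) :=
    (fderiv_apply_sum (fun k => (hd1 i k).mul (hd1 j k)) _).trans
      (Finset.sum_congr rfl fun k _ => fderiv_apply_mul (hd1 i k) (hd1 j k) _)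
  have hconv (i j : Fin 3) : sderiv j (fun w => u w i * u w j +
      ∑ k, sderiv i (fun w' => d w' k) w * sderiv j (fun w' => d w' k) w) z =
      (sderiv j (fun w => u w i) z * u z j + u z i * sderiv j (fun w => u w j) z) +
      ∑ k, (sderiv j (sderiv i fun w => d w k) z * sderiv j (fun w => d w k) z +
        sderiv i (fun w => d w k) z * sderiv j (sderiv j fun w => d w k) z) :=
    (fderiv_apply_add ((hu1 i).mul (hu1 j)) (hdd i j) _).trans
      (congrArg₂ _ (fderiv_apply_mul (hu1 i) (hu1 j) _) (hstress i j j))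
  have hSd (j : Fin 3) : sderiv j (stressFlux u d j) z =
      ∑ i, (sderiv j (fun w => u w i) z *
          (∑ k, sderiv i (fun w => d w k) z * sderiv j (fun w => d w k) z) +
        u z i * ∑ k, (sderiv j (sderiv i fun w => d w k) z * sderiv j (fun w => d w k) z +
          sderiv i (fun w => d w k) z * sderiv j (sderiv j fun w => d w k) z)) :=
    (fderiv_apply_sum (fun i => (hu1 i).mul (hdd i j)) _).trans
      (Finset.sum_congr rfl fun i _ => (fderiv_apply_mul (hu1 i) (hdd i j) _).trans
        (congrArg _ (congrArg _ (hstress i j j))))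
  have hFd (j : Fin 3) : sderiv j (energyFlux u d p j) z =
      sderiv j (sderiv j (energyDensity u d)) z -
        ((sderiv j (energyDensity u d) z + sderiv j p z) * u z j +
          (energyDensity u d z + p z) * sderiv j (fun w => u w j) z) -
        sderiv j (stressFlux u d j) z :=
    (fderiv_apply_sub ((hdE j).sub ((hE1.add hp1).mul (hu1 j))) (hS1 j) _).trans
      (congrArg₂ _ ((fderiv_apply_sub (hdE j) ((hE1.add hp1).mul (hu1 j)) _).trans
        (congrArg _ ((fderiv_apply_mul (hE1.add hp1) (hu1 j) _).trans
          (congrArg₂ _ (congrArg (· * u z j) (fderiv_apply_add hE1 hp1 _)) rfl)))) rfl)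
  have hG (j : Fin 3) : sderiv j
      (fun w => energyFlux u d p j w * φ w - energyDensity u d w * sderiv j φ w) z =
      sderiv j (energyFlux u d p j) z * φ z + energyFlux u d p j z * sderiv j φ z -
        (sderiv j (energyDensity u d) z * sderiv j φ z +
          energyDensity u d z * sderiv j (sderiv j φ) z) :=
    (fderiv_apply_sub ((hF1 j).mul hφ1) (hE1.mul (hdφ j)) _).trans
      (congrArg₂ _ (fderiv_apply_mul (hF1 j) hφ1 _) (fderiv_apply_mul hE1 (hdφ j) _))
  have ht : tderiv (fun w => energyDensity u d w * φ w) z =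
      tderiv (energyDensity u d) z * φ z + energyDensity u d z * tderiv φ z :=
    fderiv_apply_mul hE1 hφ1 _
  have hEd (v : SpT) : fderiv ℝ (energyDensity u d) z v =
      ∑ i, u z i * fderiv ℝ (fun w => u w i) z v +
        ∑ i, ∑ j, sderiv j (fun w => d w i) z *
          fderiv ℝ (sderiv j fun w => d w i) z v := by
    rw [energyDensity_eq_half_sum_sq, fderiv_apply_half_sum_sq ha1, Fintype.sum_sum_type,
      Fintype.sum_prod_type]
    rfl
  have hEdd (j : Fin 3) : sderiv j (sderiv j (energyDensity u d)) z =
      ∑ i, (u z i * sderiv j (sderiv j fun w => u w i) z + sderiv j (fun w => u w i) z ^ 2) +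
        ∑ i, ∑ l, (sderiv l (fun w => d w i) z *
          sderiv j (sderiv j (sderiv l fun w => d w i)) z +
          sderiv j (sderiv l fun w => d w i) z ^ 2) := by
    rw [energyDensity_eq_half_sum_sq]
    refine (fderiv_apply_fderiv_apply_half_sum_sq hU ha hz _).trans ?_
    rw [Fintype.sum_sum_type, Fintype.sum_prod_type]
    rfl
  simp only [hG, hFd, hSd, ht]
  simp only [energyFlux, stressFlux, sLap, cNgrad, cNgrad2]
  exact energy_density_algebra (fun i => u z i) (fun i => tderiv (fun w => u w i) z)
    (fun j => sderiv j p z) (fun j => sderiv j φ z) (fun j => sderiv j (sderiv j φ) z)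
    (fun j i => sderiv j (fun w => u w i) z) (fun j i => sderiv j (sderiv j fun w => u w i) z)
    (fun j i => sderiv j (fun w => d w i) z) (fun j i => tderiv (sderiv j fun w => d w i) z)
    (fun j i => sderiv j (fun w => 4 * (‖d w‖ ^ 2 - 1) * d w i) z)
    (fun k j i => sderiv k (sderiv j fun w => d w i) z)
    (fun k j i => sderiv k (sderiv k (sderiv j fun w => d w i)) z) (p z) (φ z) (tderiv φ z)
    (fun i => by simpa only [hconv] using hmom z hz i) (hdiv z hz)
    (fun j i => sderiv_director_equation hU hu hd hdeq hz j i) _ _ _ _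
    (hEd _) (fun _ => hEd _) hEdd

end EnergyDensity

/-- Local energy identity for smooth solutions of the liquid crystal system on `Ω × (0,T)`. -/
theorem stmt18 (Ω : Set E3) (hΩ : IsOpen Ω) (T : ℝ) (hT : 0 < T)
    (u d : SpT → E3) (p : SpT → ℝ)
    (hu : ContDiffOn ℝ (⊤ : ℕ∞) u (Ω ×ˢ Ioo 0 T))
    (hd : ContDiffOn ℝ (⊤ : ℕ∞) d (Ω ×ˢ Ioo 0 T))
    (hp : ContDiffOn ℝ (⊤ : ℕ∞) p (Ω ×ˢ Ioo 0 T))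
    (hmom : ∀ z ∈ Ω ×ˢ Ioo (0 : ℝ) T, ∀ i : Fin 3,
      tderiv (fun w => u w i) z - (∑ j, sderiv j (sderiv j (fun w => u w i)) z) +
        (∑ j, sderiv j (fun w => u w i * u w j +
          ∑ k, sderiv i (fun w' => d w' k) w * sderiv j (fun w' => d w' k) w) z) +
        sderiv i p z = 0)
    (hdiv : ∀ z ∈ Ω ×ˢ Ioo (0 : ℝ) T, ∑ i, sderiv i (fun w => u w i) z = 0)
    (hdeq : ∀ z ∈ Ω ×ˢ Ioo (0 : ℝ) T, ∀ i : Fin 3,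
      tderiv (fun w => d w i) z - (∑ j, sderiv j (sderiv j (fun w => d w i)) z) +
        (∑ j, u z j * sderiv j (fun w => d w i) z) +
        4 * (‖d z‖ ^ 2 - 1) * d z i = 0) :
    ∀ φ : SpT → ℝ, ContDiff ℝ (⊤ : ℕ∞) φ → HasCompactSupport φ →
      tsupport φ ⊆ Ω ×ˢ Ioo 0 T →
    ∀ t ∈ Ioo (0 : ℝ) T,
      HasDerivAt (fun s => ∫ x in Ω, (‖u (x, s)‖ ^ 2 / 2 + cNgrad d (x, s) / 2) * φ (x, s))
        ((∫ x in Ω,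
          ((‖u (x, t)‖ ^ 2 / 2 + cNgrad d (x, t) / 2) *
              (tderiv φ (x, t) + sLap φ (x, t)) +
            (‖u (x, t)‖ ^ 2 / 2 + cNgrad d (x, t) / 2 + p (x, t)) *
              (∑ j, u (x, t) j * sderiv j φ (x, t)) +
            (∑ i, ∑ j, u (x, t) i * sderiv j φ (x, t) *
              (∑ k, sderiv i (fun w => d w k) (x, t) * sderiv j (fun w => d w k) (x, t))) -
            φ (x, t) * (∑ i, ∑ j, sderiv j (fun w => 4 * (‖d w‖ ^ 2 - 1) * d w i) (x, t) *
              sderiv j (fun w => d w i) (x, t)))) -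
          ∫ x in Ω, (cNgrad u (x, t) + cNgrad2 d (x, t)) * φ (x, t)) t := by
  intro φ hφ hφc hφU t ht
  have hU : IsOpen (Ω ×ˢ Ioo (0 : ℝ) T) := hΩ.prod isOpen_Ioo
  have hφT : IsTestOn (Ω ×ˢ Ioo 0 T) φ := ⟨hφ, hφc, hφU⟩
  have hE := contDiffOn_energyDensity hU hu hd
  have hF := hφT.mul_left hU hE
  have hB := (hφT.mul_left hU (contDiffOn_dissipation hU hu hd)).integrable_slice t
  have hG (j : Fin 3) : IsTestOn (Ω ×ˢ Ioo 0 T) (fun w =>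
      energyFlux u d p j w * φ w - energyDensity u d w * sderiv j φ w) :=
    (hφT.mul_left hU (contDiffOn_energyFlux hU hu hd hp j)).sub
      ((hφT.fderiv_apply _).mul_left hU hE)
  have hFt : Integrable fun x : E3 => tderiv (fun w => energyDensity u d w * φ w) (x, t) :=
    (hF.fderiv_apply (0, 1)).integrable_slice t
  have hGj (j : Fin 3) : Integrable fun x : E3 => sderiv j (fun w =>
      energyFlux u d p j w * φ w - energyDensity u d w * sderiv j φ w) (x, t) :=
    ((hG j).fderiv_apply (EuclideanSpace.single j 1, 0)).integrable_slice t
  refine (hF.hasDerivAt_setIntegral_slice Ω t).congr_deriv (Eq.symm ?_)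
  refine (congrArg (· - _) (setIntegral_congr_fun hΩ.measurableSet fun x hx =>
    energy_identity_pointwise hU hu hd hp hφ hmom hdiv hdeq (z := (x, t)) ⟨hx, ht⟩)).trans ?_
  beta_reduce
  rw [integral_sub (hFt.restrict.fun_add hB.restrict)
      (integrable_finsetSum _ fun j _ => (hGj j).restrict),
    integral_add hFt.restrict hB.restrict,
    integral_finsetSum _ fun j _ => (hGj j).restrict]
  simp only [(hG _).setIntegral_sderiv_slice, Finset.sum_const_zero, sub_zero,
    add_sub_cancel_right]
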